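/- Let d ≥ 1, let Γ be an additive subsemigroup of ℕ^d × ℕ, and let t = a/b > 0 be a rational number with a, b positive integers. Define the additive subsemigroup Γ_{a,b} of ℕ^{d-1} × ℕ by Γ_{a,b} := {(σ₂, …, σ_d, k) : (a·k, σ₂, …, σ_d, b·k) ∈ Γ}. If the hyperplane {x ∈ ℝ^d : x₁ = t} meets the (topological) interior of Δ(Γ), then Δ(Γ) ∩ {x ∈ ℝ^d : x₁ = t} = {t} × (1/b)·Δ(Γ_{a,b}), where (1/b)·Δ(Γ_{a,b}) denotes the image of Δ(Γ_{a,b}) ⊆ ℝ^{d-1} under scaling by 1/b. -/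

import Mathlib

/-- The set of valuative points of an additive subsemigroup `Γ ⊆ ℕ^d × ℕ`:
points `x ∈ ℝ^d` of the form `σ / k` for some `(σ, k) ∈ Γ` with `k > 0`. -/
def valPoints {d : ℕ} (Γ : AddSubsemigroup ((Fin d → ℕ) × ℕ)) : Set (Fin d → ℝ) :=
  {x | ∃ p ∈ Γ, 0 < p.2 ∧ x = fun i => (p.1 i : ℝ) / (p.2 : ℝ)}

/-- The Newton–Okounkov body of `Γ`: the closure of the convex hull of the set of
valuative points of `Γ`. -/
def NObody {d : ℕ} (Γ : AddSubsemigroup ((Fin d → ℕ) × ℕ)) : Set (Fin d → ℝ) :=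
  closure (convexHull ℝ (valPoints Γ))

/-- The slice semigroup `Γ_{a,b} ⊆ ℕ^{d-1} × ℕ` of `Γ ⊆ ℕ^d × ℕ` (here the ambient
dimension is `d+1`): `(σ₂, …, σ_d, k) ∈ Γ_{a,b}` iff `(a·k, σ₂, …, σ_d, b·k) ∈ Γ`. -/
def sliceSemigroup (d a b : ℕ) (Γ : AddSubsemigroup ((Fin (d + 1) → ℕ) × ℕ)) :
    AddSubsemigroup ((Fin d → ℕ) × ℕ) where
  carrier := {p | ((Fin.cons (a * p.2) p.1, b * p.2) : (Fin (d + 1) → ℕ) × ℕ) ∈ Γ}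
  add_mem' := by
    intro p q hp hq
    have h := Γ.add_mem hp hq
    have e : ((Fin.cons (a * p.2) p.1, b * p.2) : (Fin (d + 1) → ℕ) × ℕ) +
        (Fin.cons (a * q.2) q.1, b * q.2) =
        (Fin.cons (a * (p + q).2) ((p + q).1), b * (p + q).2) := by
      refine Prod.ext ?_ ?_
      · funext i
        refine Fin.cases ?_ (fun j => ?_) i
        · simp [mul_add]
        · simp
      · simp [mul_add]
    rwa [e] at h

theorem AddSubsemigroup.nsmul_mem_of_pos {M : Type*} [AddMonoid M] (S : AddSubsemigroup M)
    {x : M} (hx : x ∈ S) {n : ℕ} (hn : 0 < n) : n • x ∈ S := by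
  induction n, hn using Nat.le_induction with
  | base => simpa using hx
  | succ n _ ih => rw [succ_nsmul]; exact S.add_mem ih hx

/-- The valuative points are closed under convex combinations with rational weights. -/
theorem valPoints_ratCast_combo_mem {d : ℕ} {Γ : AddSubsemigroup ((Fin d → ℕ) × ℕ)}
    {x y : Fin d → ℝ} (hx : x ∈ valPoints Γ) (hy : y ∈ valPoints Γ) {q : ℚ}
    (hq0 : 0 < q) (hq1 : q < 1) :
    (q : ℝ) • x + (1 - (q : ℝ)) • y ∈ valPoints Γ := by
  obtain ⟨p, hp, hp0, rfl⟩ := hx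
  obtain ⟨r, hr, hr0, rfl⟩ := hy
  obtain ⟨m, hm⟩ : ∃ m : ℕ, q.num = m := Int.eq_ofNat_of_zero_le (Rat.num_pos.2 hq0).le
  have hm0 : 0 < m := by have := Rat.num_pos.2 hq0; omega
  have hmn : m < q.den := by have := Rat.num_lt_denom_iff.2 hq1; omega
  obtain ⟨j, hj⟩ := Nat.exists_eq_add_of_lt hmn
  have hq : (q : ℝ) = m / (m + (j + 1)) := by
    rw [Rat.cast_def, hm, hj]; push_cast; ring
  have hp' : (p.2 : ℝ) ≠ 0 := by positivity
  have hr' : (r.2 : ℝ) ≠ 0 := by positivity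
  refine ⟨(m * r.2) • p + ((j + 1) * p.2) • r, Γ.add_mem
    (Γ.nsmul_mem_of_pos hp (by positivity)) (Γ.nsmul_mem_of_pos hr (by positivity)), ?_, ?_⟩
  · simp only [Prod.snd_add, Prod.smul_snd, smul_eq_mul]
    positivity
  · funext i
    have hmj : (m : ℝ) + (j + 1) ≠ 0 := by positivity
    have hden : (m : ℝ) * r.2 * p.2 + (j + 1) * p.2 * r.2 ≠ 0 := by positivity
    simp only [hq, Pi.add_apply, Pi.smul_apply, smul_eq_mul, Prod.fst_add, Prod.snd_add,
      Prod.smul_fst, Prod.smul_snd, Nat.cast_add, Nat.cast_mul, Nat.cast_one]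
    field_simp
    ring

theorem convex_closure_valPoints {d : ℕ} (Γ : AddSubsemigroup ((Fin d → ℕ) × ℕ)) :
    Convex ℝ (closure (valPoints Γ)) := by
  rw [convex_iff_forall_pos]
  intro x hx y hy s t hs ht hst
  obtain rfl : t = 1 - s := by linarith
  have key : ∀ u ∈ valPoints Γ, ∀ v ∈ valPoints Γ,
      s • u + (1 - s) • v ∈ closure (valPoints Γ) := by
    intro u hu v hv
    have hs' : s ∈ closure (Set.Ioo (0 : ℝ) 1 ∩ Set.range ((↑) : ℚ → ℝ)) :=
      Rat.denseRange_cast.open_subset_closure_inter isOpen_Ioo ⟨hs, by linarith⟩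
    refine map_mem_closure (f := fun s : ℝ => s • u + (1 - s) • v) (by fun_prop) hs' ?_
    rintro _ ⟨⟨h0, h1⟩, q, rfl⟩
    exact valPoints_ratCast_combo_mem hu hv (by exact_mod_cast h0) (by exact_mod_cast h1)
  have := map_mem_closure₂ (f := fun u v : Fin d → ℝ => s • u + (1 - s) • v)
    (by fun_prop) hx hy key
  rwa [closure_closure] at this

theorem NObody_eq_closure_valPoints {d : ℕ} (Γ : AddSubsemigroup ((Fin d → ℕ) × ℕ)) :
    NObody Γ = closure (valPoints Γ) :=
  (closure_minimal (convexHull_min subset_closure (convex_closure_valPoints Γ))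
    isClosed_closure).antisymm (closure_mono (subset_convexHull ℝ _))

/-- Interior points of `NObody Γ` on a rational hyperplane `x 0 = c` are limits of valuative
points on that hyperplane. -/
theorem interior_NObody_inter_subset {d : ℕ} (Γ : AddSubsemigroup ((Fin (d + 1) → ℕ) × ℕ))
    (c : ℚ) :
    interior (NObody Γ) ∩ {x | x 0 = (c : ℝ)} ⊆ closure (valPoints Γ ∩ {x | x 0 = (c : ℝ)}) := by
  rintro x ⟨hx, hxc : x 0 = c⟩
  rw [Metric.mem_closure_iff]
  intro ε hε
  have approx : ∀ U : Set ℝ, IsOpen U → (c : ℝ) ∈ closure U →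
      ∃ u ∈ valPoints Γ, u ∈ Metric.ball x ε ∧ u 0 ∈ U := by
    intro U hU hcU
    have hO : IsOpen (interior (NObody Γ) ∩ Metric.ball x ε) :=
      isOpen_interior.inter Metric.isOpen_ball
    have hupd : Continuous fun r : ℝ => Function.update x 0 r := by fun_prop
    have hx0 : Function.update x 0 (c : ℝ) = x := by rw [← hxc, Function.update_eq_self]
    obtain ⟨r, hr, hrU⟩ := mem_closure_iff.1 hcU _ (hO.preimage hupd)
      (by simpa [hx0] using ⟨hx, hε⟩)
    have hmem : Function.update x 0 r ∈ closure (valPoints Γ) := by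
      rw [← NObody_eq_closure_valPoints]; exact interior_subset hr.1
    obtain ⟨u, ⟨hu, huU⟩, huV⟩ := mem_closure_iff.1 hmem _
      (hO.inter (hU.preimage (continuous_apply 0))) ⟨hr, by simpa using hrU⟩
    exact ⟨u, huV, hu.2, huU⟩
  obtain ⟨u, hu, hux, huc : u 0 < c⟩ := approx (Set.Iio c) isOpen_Iio (by simp)
  obtain ⟨w, hw, hwx, hwc : (c : ℝ) < w 0⟩ := approx (Set.Ioi c) isOpen_Ioi (by simp)
  have rational : ∀ v ∈ valPoints Γ, ∃ r : ℚ, v 0 = r := by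
    rintro _ ⟨p, -, -, rfl⟩
    exact ⟨p.1 0 / p.2, by push_cast; rfl⟩
  obtain ⟨u₀, hu₀⟩ := rational u hu
  obtain ⟨w₀, hw₀⟩ := rational w hw
  rw [hu₀] at huc
  rw [hw₀] at hwc
  have h₁ : u₀ < c := by exact_mod_cast huc
  have h₂ : c < w₀ := by exact_mod_cast hwc
  have hq0 : 0 < (w₀ - c) / (w₀ - u₀) := div_pos (by linarith) (by linarith)
  have hq1 : (w₀ - c) / (w₀ - u₀) < 1 := (div_lt_one (by linarith)).2 (by linarith)
  refine ⟨_, ⟨valPoints_ratCast_combo_mem hu hw hq0 hq1, ?_⟩, ?_⟩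
  · have hne : (w₀ : ℝ) - u₀ ≠ 0 := by linarith
    simp only [Set.mem_ofPred_eq, Pi.add_apply, Pi.smul_apply, smul_eq_mul, hu₀, hw₀]
    push_cast
    field_simp
    ring
  · rw [dist_comm]
    exact convex_ball x ε hux hwx (by exact_mod_cast hq0.le)
      (by rw [sub_nonneg]; exact_mod_cast hq1.le) (by ring)

theorem NObody_inter_subset_closure {d : ℕ} (Γ : AddSubsemigroup ((Fin (d + 1) → ℕ) × ℕ))
    (c : ℚ) (hmeet : ({x | x 0 = (c : ℝ)} ∩ interior (NObody Γ)).Nonempty) :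
    NObody Γ ∩ {x | x 0 = (c : ℝ)} ⊆ closure (valPoints Γ ∩ {x | x 0 = (c : ℝ)}) := by
  rintro x ⟨hx, hxc⟩
  obtain ⟨p, hpc, hp⟩ := hmeet
  have hconv : Convex ℝ (NObody Γ) := (convex_convexHull ℝ _).closure
  have hslice : Convex ℝ {x : Fin (d + 1) → ℝ | x 0 = (c : ℝ)} :=
    convex_hyperplane (LinearMap.proj (R := ℝ) (φ := fun _ : Fin (d + 1) => ℝ) 0).isLinear _
  have hsub : openSegment ℝ p x ⊆ closure (valPoints Γ ∩ {x | x 0 = (c : ℝ)}) := fun y hy =>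
    interior_NObody_inter_subset Γ c ⟨hconv.openSegment_interior_self_subset_interior hp hx hy,
      hslice.openSegment_subset hpc hxc hy⟩
  refine closure_minimal hsub isClosed_closure ?_
  rw [closure_openSegment]
  exact right_mem_segment ℝ p x

theorem cons_mem_valPoints {d a b : ℕ} (hb : 0 < b)
    {Γ : AddSubsemigroup ((Fin (d + 1) → ℕ) × ℕ)} {y : Fin d → ℝ}
    (hy : y ∈ valPoints (sliceSemigroup d a b Γ)) :
    (Fin.cons ((a : ℝ) / (b : ℝ)) (((b : ℝ)⁻¹) • y) : Fin (d + 1) → ℝ) ∈ valPoints Γ := by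
  obtain ⟨p, hp, hp0, rfl⟩ := hy
  have hb' : (b : ℝ) ≠ 0 := by positivity
  have hp' : (p.2 : ℝ) ≠ 0 := by positivity
  refine ⟨_, hp, by positivity, ?_⟩
  funext i
  refine Fin.cases ?_ (fun j => ?_) i
  · simp; field_simp
  · simp; field_simp

theorem smul_tail_mem_valPoints {d a b : ℕ} (hb : 0 < b)
    {Γ : AddSubsemigroup ((Fin (d + 1) → ℕ) × ℕ)} {x : Fin (d + 1) → ℝ}
    (hx : x ∈ valPoints Γ) (hx0 : x 0 = (a : ℝ) / (b : ℝ)) :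
    (b : ℝ) • (fun i : Fin d => x i.succ) ∈ valPoints (sliceSemigroup d a b Γ) := by
  obtain ⟨p, hp, hp0, rfl⟩ := hx
  have hb' : (b : ℝ) ≠ 0 := by positivity
  have hp' : (p.2 : ℝ) ≠ 0 := by positivity
  have hx1 : b * p.1 0 = a * p.2 := by
    rw [div_eq_div_iff hp' hb'] at hx0
    rw [mul_comm]
    exact_mod_cast hx0
  refine ⟨(fun i => b * p.1 i.succ, p.2), ?_, hp0, ?_⟩
  · have h := Γ.nsmul_mem_of_pos hp hb
    have e : b • p = ((Fin.cons (a * p.2) fun i => b * p.1 i.succ, b * p.2) :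
        (Fin (d + 1) → ℕ) × ℕ) := by
      refine Prod.ext ?_ (by simp)
      funext i
      refine Fin.cases ?_ (fun j => ?_) i
      · simpa using hx1
      · simp
    rw [e] at h
    exact h
  · funext i
    simp [mul_div_assoc]

/-- slice formula at a rational `t = a/b > 0`: if the hyperplane
`{x₁ = a/b}` meets the interior of `Δ(Γ)`, then the slice `Δ(Γ) ∩ {x₁ = a/b}` equals
`{a/b} × (1/b)·Δ(Γ_{a,b})`.  The ambient dimension is `d + 1 ≥ 1`. -/
theorem NObody_slice_formula {d : ℕ} (a b : ℕ) (ha : 0 < a) (hb : 0 < b)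
    (Γ : AddSubsemigroup ((Fin (d + 1) → ℕ) × ℕ))
    (hmeet : ({x : Fin (d + 1) → ℝ | x 0 = (a : ℝ) / (b : ℝ)} ∩
      interior (NObody Γ)).Nonempty) :
    NObody Γ ∩ {x : Fin (d + 1) → ℝ | x 0 = (a : ℝ) / (b : ℝ)} =
      (fun y : Fin d → ℝ => Fin.cons ((a : ℝ) / (b : ℝ)) (((b : ℝ)⁻¹) • y)) ''
        NObody (sliceSemigroup d a b Γ) := by
  have hb' : (b : ℝ) ≠ 0 := by positivity
  apply Set.Subset.antisymm
  · intro x hx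
    have hc : ((a / b : ℚ) : ℝ) = (a : ℝ) / (b : ℝ) := by push_cast; rfl
    have hcl := NObody_inter_subset_closure Γ (a / b : ℚ) (by rwa [hc]) (by rwa [hc])
    rw [hc] at hcl
    refine ⟨(b : ℝ) • (fun i : Fin d => x i.succ), ?_, ?_⟩
    · rw [NObody_eq_closure_valPoints]
      exact map_mem_closure (f := fun x : Fin (d + 1) → ℝ => (b : ℝ) • fun i : Fin d => x i.succ)
        (by fun_prop) hcl fun v hv => smul_tail_mem_valPoints hb hv.1 hv.2
    · have hx0 : x 0 = (a : ℝ) / (b : ℝ) := hx.2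
      funext i
      refine Fin.cases ?_ (fun j => ?_) i
      · simp [hx0]
      · simp [hb']
  · rintro _ ⟨y, hy, rfl⟩
    refine ⟨?_, by simp⟩
    rw [NObody_eq_closure_valPoints] at hy ⊢
    refine map_mem_closure (f := fun y : Fin d → ℝ =>
      (Fin.cons ((a : ℝ) / (b : ℝ)) (((b : ℝ)⁻¹) • y) : Fin (d + 1) → ℝ)) ?_ hy
      fun v hv => cons_mem_valPoints hb hv
    refine continuous_pi fun i => Fin.cases ?_ (fun j => ?_) i
    · simpa using continuous_const
    · simp only [Fin.cons_succ]
      fun_prop
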